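/- A semiring S is a band orthoring if and only if S is a spined product of a band semiring and a weak Clifford semiring with respect to a distributive lattice; that is, if and only if there exist a band semiring S₁ (an idempotent semiring satisfying x + yxy + x = x), a weak Clifford semiring S₂, a distributive lattice T (an idempotent semiring with commutative + and · satisfying a + ab = a), surjective homomorphisms φ₁ : S₁ → T and φ₂ : S₂ → T, and a bijection from S onto {(a,b) ∈ S₁ × S₂ : φ₁(a) = φ₂(b)} preserving + and ·. -/

import Mathlib

universe u

/-- A bundled semiring in the sense of this paper. -/
structure RawSemiring : Type (u + 1) where
  carrier : Type u
  add : carrier → carrier → carrier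
  mul : carrier → carrier → carrier
  add_assoc : ∀ a b c, add (add a b) c = add a (add b c)
  mul_assoc : ∀ a b c, mul (mul a b) c = mul a (mul b c)
  left_distrib : ∀ a b c, mul a (add b c) = add (mul a b) (mul a c)
  right_distrib : ∀ a b c, mul (add a b) c = add (mul a c) (mul b c)

/-- A bundled completely regular semiring: a semiring with a unary operation
`inv` satisfying the five defining identities (with `x° := x + inv x`). -/
structure RawCRSemiring : Type (u + 1) where
  carrier : Type u
  add : carrier → carrier → carrier
  mul : carrier → carrier → carrier
  inv : carrier → carrier
  add_assoc : ∀ a b c, add (add a b) c = add a (add b c)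
  mul_assoc : ∀ a b c, mul (mul a b) c = mul a (mul b c)
  left_distrib : ∀ a b c, mul a (add b c) = add (mul a b) (mul a c)
  right_distrib : ∀ a b c, mul (add a b) c = add (mul a c) (mul b c)
  cr1 : ∀ x, add (add x (inv x)) x = x
  cr2 : ∀ x, add x (inv x) = add (inv x) x
  cr3 : ∀ x, inv (inv x) = x
  cr4 : ∀ x y, add (add (add x (add y (inv y))) (add x (inv x))) y =
      add (add (add (add x (inv x)) y) x) (add y (inv y))
  cr5 : ∀ x, mul x (add x (inv x)) = add x (inv x)

/-- A band semiring: an idempotent semiring with `x + yxy + x = x`. -/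
def RawSemiring.IsBandSemiring (A : RawSemiring.{u}) : Prop :=
  (∀ a, A.add a a = a) ∧ (∀ a, A.mul a a = a) ∧
    (∀ x y, A.add (A.add x (A.mul (A.mul y x) y)) x = x)

/-- A distributive lattice: idempotent semiring with commutative `+` and `·`
satisfying `a + ab = a`. -/
def RawSemiring.IsDistLat (T : RawSemiring.{u}) : Prop :=
  (∀ a, T.add a a = a) ∧ (∀ a, T.mul a a = a) ∧
    (∀ a b, T.add a b = T.add b a) ∧ (∀ a b, T.mul a b = T.mul b a) ∧
    (∀ a b, T.add a (T.mul a b) = a)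

/-- A weak Clifford semiring: a completely regular semiring with commutative
addition satisfying `a(a+a′) = a+a′`, `a(b+b′) = (b+b′)a` and
`a + a(b+b′) = a`. -/
def RawCRSemiring.IsWeakClifford (A : RawCRSemiring.{u}) : Prop :=
  (∀ a b, A.add a b = A.add b a) ∧
    (∀ a, A.mul a (A.add a (A.inv a)) = A.add a (A.inv a)) ∧
    (∀ a b, A.mul a (A.add b (A.inv b)) = A.mul (A.add b (A.inv b)) a) ∧
    (∀ a b, A.add a (A.mul a (A.add b (A.inv b))) = a)

/-- A semiring homomorphism between (the operations of) two algebras. -/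
def IsHom {α : Type u} {β : Type u} (addA mulA : α → α → α)
    (addB mulB : β → β → β) (f : α → β) : Prop :=
  (∀ a b, f (addA a b) = addB (f a) (f b)) ∧
    (∀ a b, f (mulA a b) = mulB (f a) (f b))
/-- Band orthorings, as a class: `o x = x + inv x`. -/
class BandOrthoring (S : Type u) extends AddSemigroup S, Mul S where
  inv : S → S
  mul_assoc' : ∀ a b c : S, a * b * c = a * (b * c)
  left_distrib' : ∀ a b c : S, a * (b + c) = a * b + a * c
  right_distrib' : ∀ a b c : S, (a + b) * c = a * c + b * c
  cr1 : ∀ x : S, x + inv x + x = x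
  cr2 : ∀ x : S, x + inv x = inv x + x
  cr3 : ∀ x : S, inv (inv x) = x
  cr4 : ∀ x y : S,
    x + (y + inv y) + (x + inv x) + y = (x + inv x) + y + x + (y + inv y)
  cr5 : ∀ x : S, x * (x + inv x) = x + inv x
  idem_add : ∀ {e f : S}, e + e = e → f + f = f → (e + f) + (e + f) = e + f
  band_right : ∀ {e f : S}, e + e = e → f + f = f → e + e * f + e = e
  band_left : ∀ {e f : S}, e + e = e → f + f = f → e + f * e + e = e

namespace BandOrthoring

section Band

variable {S : Type u} [AddSemigroup S]

/-- The quasi-order `e + f + e = e` on the idempotents of an additive semigroup. -/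
def Below (e f : S) : Prop := e + f + e = e

theorem below_add_iff {u e f : S} (hu : u + u = u) (he : e + e = e) (hf : f + f = f)
    (idem : ∀ {e f : S}, e + e = e → f + f = f → (e + f) + (e + f) = e + f) :
    Below u (e + f) ↔ Below u e ∧ Below u f := by
  unfold Below
  constructor
  · intro h
    have h1 := idem hu he
    have h2 := idem hf hu
    constructor
    · grind
    · grind
  · rintro ⟨h1, h2⟩
    have h3 := idem (idem hf hu) (idem hu he)
    grind

theorem Below.trans {e f g : S} (he : e + e = e) (hf : f + f = f) (hg : g + g = g)
    (idem : ∀ {e f : S}, e + e = e → f + f = f → (e + f) + (e + f) = e + f)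
    (h : Below e f) (h' : Below f g) : Below e g := by
  have : Below e (f + (g + f)) := by unfold Below at *; grind
  exact ((below_add_iff he hg hf idem).1
    ((below_add_iff he hf (idem hg hf) idem).1 this).2).1

end Band

variable {S : Type u} [BandOrthoring S]

/-- The additive idempotent `x + inv x` of the maximal subgroup containing `x`. -/
def o (x : S) : S := x + inv x

theorem add_o (x : S) : x + o x = x := by
  have := cr1 x; have := cr2 x; unfold o; grind

theorem o_add (x : S) : o x + x = x := cr1 x

theorem o_idem (x : S) : o x + o x = o x := by
  have := cr1 x; unfold o; grind

theorem inv_add (x : S) : inv x + x = o x := (cr2 x).symm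

theorem add_inv (x : S) : x + inv x = o x := rfl

theorem o_of_idem {e : S} (he : e + e = e) : o e = e := by
  have := cr1 e; have := cr2 e; unfold o; grind

theorem add_eq_o {x y : S} (h : x + y + x = x) (h' : x + y = y + x) : x + y = o x := by
  calc x + y = x + inv x + x + y := by rw [cr1]
    _ = inv x + x + (x + y) := by rw [cr2, add_assoc]
    _ = inv x + (x + y + x) := by rw [add_assoc x y x, ← h', add_assoc]
    _ = o x := by rw [h, inv_add]

theorem o_inv (x : S) : o (inv x) = o x := by
  unfold o; rw [cr3, cr2]

theorem o_mul_left (a b : S) : o a * b = o (a * b) := by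
  rw [← add_eq_o (x := a * b) (y := inv a * b)]
  · exact right_distrib' _ _ _
  · rw [← right_distrib', ← right_distrib', cr1]
  · rw [← right_distrib', ← right_distrib', cr2]

theorem o_mul_right (a b : S) : a * o b = o (a * b) := by
  rw [← add_eq_o (x := a * b) (y := a * inv b)]
  · exact left_distrib' _ _ _
  · rw [← left_distrib', ← left_distrib', cr1]
  · rw [← left_distrib', ← left_distrib', cr2]

theorem o_mul (a b : S) : o (a * b) = o a * o b := by
  rw [o_mul_left, o_mul_right, o_of_idem (o_idem _)]

theorem mul_idem {e : S} (f : S) (he : e + e = e) : e * f + e * f = e * f := by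
  rw [← right_distrib', he]

theorem mul_self_of_idem {e : S} (he : e + e = e) : e * e = e := by
  have := cr5 e
  rwa [add_inv, o_of_idem he] at this

theorem exists_eq_add_right {z p k q : S} (h : z = p + z + k + q) : ∃ s, z = z + k + s := by
  have h1 := add_o (k + q)
  have h2 := add_inv (k + q)
  refine ⟨q + inv (k + q), ?_⟩
  grind

theorem exists_eq_add_left {z p k q : S} (h : z = p + k + z + q) : ∃ s, z = s + k + z := by
  have h1 := o_add (p + k)
  have h2 := inv_add (p + k)
  refine ⟨inv (p + k) + p, ?_⟩
  rw [add_assoc (inv _), h2, h]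
  simp only [← add_assoc] at h1 ⊢
  rw [h1]

theorem add_add_of_eq {a b c : S} (h : a + b = c) (z : S) : a + (b + z) = c + z := by
  rw [← add_assoc, h]

theorem o_add_eq (x y : S) : o (x + y) = o x + o y := by
  have hv : (o x + o y) + (o x + o y) = o x + o y := idem_add (o_idem x) (o_idem y)
  have hQ : x + o y + o x + y = o x + y + x + o y := cr4 x y
  have hx1 := add_o x
  have hx3 := inv_add x
  have hy2 := o_add y
  have hy4 := add_inv y
  have hd1 := add_o (x + y)
  have hd2 := o_add (x + y)
  have hd4 := add_inv (x + y)
  have hxy : x + y = x + (o x + y + x + o y) + y + inv (x + y) := by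
    calc x + y = x + y + (x + y + inv (x + y)) := by rw [hd4, hd1]
      _ = (x + o x) + y + (x + (o y + y) + inv (x + y)) := by rw [hx1, hy2]
      _ = _ := by simp only [add_assoc]
  have hv1 : o x + o y = inv x + (x + y) + inv y := by
    rw [← add_assoc, hx3, add_assoc, hy4]
  obtain ⟨s, hs⟩ := exists_eq_add_right (z := o x + o y) (p := inv x + x)
    (k := y + x + o y) (q := y + inv (x + y) + inv y) (by
      refine hv1.trans ((congrArg (inv x + · + inv y) hxy).trans ?_)
      simp only [add_assoc, add_add_of_eq hx3, add_add_of_eq hx1, add_add_of_eq hy2])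
  obtain ⟨t, ht⟩ := exists_eq_add_left (z := o x + o y) (p := inv x + x)
    (k := o x + y + x) (q := y + inv (x + y) + inv y) (by
      refine hv1.trans ((congrArg (inv x + · + inv y) hxy).trans ?_)
      simp only [add_assoc, add_add_of_eq hx3, add_add_of_eq hx1, add_add_of_eq hy2])
  have hs' : o x + o y = o x + y + x + o y + s := by
    rw [hs]
    simp only [add_assoc, add_add_of_eq hy2]
  have ht' : o x + o y = t + (o x + y + x + o y) := by
    rw [ht]
    simp only [add_assoc, add_add_of_eq hx1]
  have hwv : o (x + y) + (o x + o y) = o x + o y := by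
    have h : o x + o y = (x + y) + (inv y + o x + y + s) := by
      rw [hs', ← hQ, ← hy4]
      simp only [add_assoc]
    rw [h, ← add_assoc, hd2]
  have hvw : (o x + o y) + o (x + y) = o x + o y := by
    have h : o x + o y = (t + x + o y + inv x) + (x + y) := by
      rw [ht', ← hQ, ← hx3]
      simp only [add_assoc]
    rw [h, add_assoc, hd1]
  obtain ⟨r, hr⟩ := exists_eq_add_right (z := o (x + y)) (p := x)
    (k := o x + o y) (q := y + inv (x + y)) (by
      rw [add_assoc x, hwv, ← hd4]
      simp only [add_assoc, add_add_of_eq hx1, add_add_of_eq hy2])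
  rw [hwv] at hr
  rw [← hvw, hr, ← add_assoc, hv]

theorem o_comm {x y : S} (h : o x = o y) : x + y = y + x := by
  have := cr4 x y
  rw [add_inv, add_inv, ← h] at this
  have hx1 := add_o x
  have hx2 := o_add x
  have hy1 := add_o y
  have hy2 := o_add y
  grind

section Local

variable {u x y : S}

theorem below_o_add_iff (hu : u + u = u) :
    Below u (o (x + y)) ↔ Below u (o x) ∧ Below u (o y) := by
  rw [o_add_eq]
  exact below_add_iff hu (o_idem x) (o_idem y) idem_add

theorem sandwich_add (hu : u + u = u) (hx : Below u (o x)) (hy : Below u (o y)) :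
    u + (x + y) + u = (u + x + u) + (u + y + u) := by
  have h := (below_add_iff hu (o_idem x) (o_idem y) idem_add).2 ⟨hx, hy⟩
  unfold Below at h
  have h1 := add_o (u + x)
  have h2 := o_add (y + u)
  rw [o_add_eq, o_of_idem hu] at h1 h2
  grind

theorem o_sandwich (hu : u + u = u) (hx : Below u (o x)) : o (u + x + u) = u := by
  rw [o_add_eq, o_add_eq, o_of_idem hu]
  exact hx

theorem sandwich_comm (hu : u + u = u) (hx : Below u (o x)) (hy : Below u (o y)) :
    u + (x + y) + u = u + (y + x) + u := by
  rw [sandwich_add hu hx hy, sandwich_add hu hy hx]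
  exact o_comm (by rw [o_sandwich hu hx, o_sandwich hu hy])

theorem sandwich_inv (hu : u + u = u) (hx : Below u (o x)) (hy : Below u (o y))
    (h : u + x + u = u + y + u) : u + inv x + u = u + inv y + u := by
  have h1 : Below u (o (inv x)) := by rwa [o_inv]
  have h2 : Below u (o (inv y)) := by rwa [o_inv]
  have e1 := sandwich_add hu h1 hx
  have e2 := sandwich_add hu hy h2
  rw [inv_add, hx] at e1
  rw [add_inv, hy] at e2
  grind

end Local

theorem Below.mul_right {e f : S} (h : Below e f) (c : S) : Below (e * c) (f * c) := by
  unfold Below at *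
  rw [← right_distrib', ← right_distrib', h]

theorem Below.mul_left {e f : S} (h : Below e f) (c : S) : Below (c * e) (c * f) := by
  unfold Below at *
  rw [← left_distrib', ← left_distrib', h]

theorem below_refl {e : S} (he : e + e = e) : Below e e := by
  unfold Below; rw [he, he]

theorem below_sandwich {e f : S} (he : e + e = e) (hf : f + f = f) : Below e (f * e * f) :=
  Below.trans he (mul_idem e hf) (mul_idem f (mul_idem e hf)) idem_add
    (band_left he hf) (band_right (mul_idem e hf) hf)

theorem below_mul_comm {e f : S} (he : e + e = e) (hf : f + f = f) :
    Below (e * f) (f * e) := by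
  have h := mul_idem f he
  have h1 : Below (e * f) (f * (e * f)) := band_left h hf
  have h2 : Below (f * (e * f)) (f * (e * f) * e) := band_right (mul_idem _ hf) he
  have h3 : f * (e * f) * e = f * e := by
    rw [← mul_assoc', mul_assoc' (f * e)]
    exact mul_self_of_idem (mul_idem e hf)
  rw [h3] at h2
  exact h1.trans h (mul_idem _ hf) (mul_idem _ hf) idem_add h2

variable (S) in
/-- The least distributive lattice congruence. -/
def latticeSetoid : Setoid S where
  r a b := ∀ u : S, u + u = u → (Below u (o a) ↔ Below u (o b))
  iseqv := ⟨fun _ _ _ => Iff.rfl, fun h u hu => (h u hu).symm,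
    fun h h' u hu => (h u hu).trans (h' u hu)⟩

variable (S) in
/-- The least weak Clifford congruence. -/
def cliffordSetoid : Setoid S where
  r a b := ∀ u : S, u + u = u → (Below u (o a) ↔ Below u (o b)) ∧
    (Below u (o a) → u + a + u = u + b + u)
  iseqv := ⟨fun _ _ _ => ⟨Iff.rfl, fun _ => rfl⟩,
    fun h u hu => ⟨(h u hu).1.symm, fun k => ((h u hu).2 ((h u hu).1.2 k)).symm⟩,
    fun h h' u hu => ⟨(h u hu).1.trans (h' u hu).1,
      fun k => ((h u hu).2 k).trans ((h' u hu).2 ((h u hu).1.1 k))⟩⟩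

theorem lattice_iff {a b : S} :
    latticeSetoid S a b ↔ Below (o a) (o b) ∧ Below (o b) (o a) :=
  ⟨fun h => ⟨(h _ (o_idem a)).1 (below_refl (o_idem a)),
    (h _ (o_idem b)).2 (below_refl (o_idem b))⟩,
   fun h _ hu => ⟨fun k => k.trans hu (o_idem a) (o_idem b) idem_add h.1,
    fun k => k.trans hu (o_idem b) (o_idem a) idem_add h.2⟩⟩

theorem lattice_of_clifford {a b : S} (h : cliffordSetoid S a b) : latticeSetoid S a b :=
  fun u hu => (h u hu).1

theorem lattice_add {a b c d : S} (h : latticeSetoid S a b) (h' : latticeSetoid S c d) :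
    latticeSetoid S (a + c) (b + d) := fun u hu => by
  rw [below_o_add_iff hu, below_o_add_iff hu, h u hu, h' u hu]

theorem lattice_mul {a b c d : S} (h : latticeSetoid S a b) (h' : latticeSetoid S c d) :
    latticeSetoid S (a * c) (b * d) := by
  apply (latticeSetoid S).trans' (y := b * c)
  · rw [lattice_iff] at h ⊢
    rw [o_mul, o_mul]
    exact ⟨h.1.mul_right _, h.2.mul_right _⟩
  · rw [lattice_iff] at h' ⊢
    rw [o_mul, o_mul]
    exact ⟨h'.1.mul_left _, h'.2.mul_left _⟩

theorem clifford_add {a b c d : S} (h : cliffordSetoid S a b) (h' : cliffordSetoid S c d) :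
    cliffordSetoid S (a + c) (b + d) := fun u hu => by
  refine ⟨lattice_add (lattice_of_clifford h) (lattice_of_clifford h') u hu, fun k => ?_⟩
  obtain ⟨k1, k2⟩ := (below_o_add_iff hu).1 k
  rw [sandwich_add hu k1 k2, sandwich_add hu ((h u hu).1.1 k1) ((h' u hu).1.1 k2),
    (h u hu).2 k1, (h' u hu).2 k2]

theorem clifford_inv {a b : S} (h : cliffordSetoid S a b) :
    cliffordSetoid S (inv a) (inv b) := fun u hu => by
  rw [o_inv, o_inv]
  exact ⟨(h u hu).1, fun k => sandwich_inv hu k ((h u hu).1.1 k) ((h u hu).2 k)⟩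

theorem eq_of_clifford {a b : S} (h : cliffordSetoid S a b) : a = o a + b + o a := by
  have := (h _ (o_idem a)).2 (below_refl (o_idem a))
  rwa [o_add, add_o] at this

theorem clifford_sandwich {e b : S} (he : e + e = e) (h : latticeSetoid S e b) :
    cliffordSetoid S (e + b + e) b := fun u hu => by
  have h' := h u hu
  have ho := o_of_idem he
  rw [ho] at h'
  have hb : Below u (o (e + b + e)) ↔ Below u (o b) := by
    rw [below_o_add_iff hu, below_o_add_iff hu, ho, h']
    tauto
  refine ⟨hb, fun k => ?_⟩
  obtain ⟨k1, k2⟩ := (below_o_add_iff hu).1 k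
  obtain ⟨k3, k4⟩ := (below_o_add_iff hu).1 k1
  rw [sandwich_add hu k1 k2, sandwich_add hu k3 k4]
  rw [ho] at k2
  rw [k2]
  grind

theorem clifford_mul_right {a b : S} (h : cliffordSetoid S a b) (c : S) :
    cliffordSetoid S (a * c) (b * c) := by
  have e := eq_of_clifford h
  rw [e, right_distrib', right_distrib', o_mul_left]
  refine clifford_sandwich (o_idem _) ?_
  have := lattice_mul (lattice_of_clifford h) ((latticeSetoid S).refl' c)
  intro u hu
  rw [o_of_idem (o_idem _)]
  exact this u hu

theorem clifford_mul_left {a b : S} (h : cliffordSetoid S a b) (c : S) :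
    cliffordSetoid S (c * a) (c * b) := by
  have e := eq_of_clifford h
  rw [e, left_distrib', left_distrib', o_mul_right]
  refine clifford_sandwich (o_idem _) ?_
  have := lattice_mul ((latticeSetoid S).refl' c) (lattice_of_clifford h)
  intro u hu
  rw [o_of_idem (o_idem _)]
  exact this u hu

theorem clifford_mul {a b c d : S} (h : cliffordSetoid S a b) (h' : cliffordSetoid S c d) :
    cliffordSetoid S (a * c) (b * d) :=
  (cliffordSetoid S).trans' (clifford_mul_right h c) (clifford_mul_left h' b)

theorem clifford_of_idem {e f : S} (he : e + e = e) (hf : f + f = f)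
    (h : latticeSetoid S e f) : cliffordSetoid S e f := fun u hu => by
  refine ⟨h u hu, fun k => ?_⟩
  have k' := (h u hu).1 k
  rw [o_of_idem he] at k
  rw [o_of_idem hf] at k'
  rw [k, k']

theorem lattice_mul_comm (a b : S) : latticeSetoid S (a * b) (b * a) := by
  rw [lattice_iff, o_mul, o_mul]
  exact ⟨below_mul_comm (o_idem a) (o_idem b), below_mul_comm (o_idem b) (o_idem a)⟩

theorem below_o_mul (a b : S) : Below (o a) (o (a * b)) := by
  rw [o_mul]
  exact band_right (o_idem a) (o_idem b)

theorem lattice_absorb (a b : S) : latticeSetoid S (a + a * b) a := fun u hu => by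
  rw [below_o_add_iff hu]
  exact ⟨And.left, fun k => ⟨k, k.trans hu (o_idem a) (o_idem _) idem_add (below_o_mul a b)⟩⟩

theorem clifford_absorb (a b : S) : cliffordSetoid S (a + a * o b) a := fun u hu => by
  refine ⟨lattice_absorb a (o b) u hu, fun k => ?_⟩
  obtain ⟨k1, k2⟩ := (below_o_add_iff hu).1 k
  rw [sandwich_add hu k1 k2]
  rw [o_mul_right, o_of_idem (o_idem _)] at k2
  rw [o_mul_right, k2]
  grind

variable (S) in
/-- The band semiring of additive idempotents. -/
def idempotents : RawSemiring.{u} where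
  carrier := {e : S // e + e = e}
  add e f := ⟨e.1 + f.1, idem_add e.2 f.2⟩
  mul e f := ⟨e.1 * f.1, mul_idem _ e.2⟩
  add_assoc _ _ _ := Subtype.ext (add_assoc _ _ _)
  mul_assoc _ _ _ := Subtype.ext (mul_assoc' _ _ _)
  left_distrib _ _ _ := Subtype.ext (left_distrib' _ _ _)
  right_distrib _ _ _ := Subtype.ext (right_distrib' _ _ _)

variable (S) in
/-- The greatest weak Clifford quotient. -/
def cliffordQuotient : RawCRSemiring.{u} where
  carrier := Quotient (cliffordSetoid S)
  add := Quotient.map₂ (· + ·) fun _ _ h _ _ h' => clifford_add h h'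
  mul := Quotient.map₂ (· * ·) fun _ _ h _ _ h' => clifford_mul h h'
  inv := Quotient.map inv fun _ _ h => clifford_inv h
  add_assoc := by
    rintro ⟨a⟩ ⟨b⟩ ⟨c⟩; exact congrArg (Quotient.mk _) (add_assoc a b c)
  mul_assoc := by
    rintro ⟨a⟩ ⟨b⟩ ⟨c⟩; exact congrArg (Quotient.mk _) (mul_assoc' a b c)
  left_distrib := by
    rintro ⟨a⟩ ⟨b⟩ ⟨c⟩; exact congrArg (Quotient.mk _) (left_distrib' a b c)
  right_distrib := by
    rintro ⟨a⟩ ⟨b⟩ ⟨c⟩; exact congrArg (Quotient.mk _) (right_distrib' a b c)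
  cr1 := by rintro ⟨a⟩; exact congrArg (Quotient.mk _) (cr1 a)
  cr2 := by rintro ⟨a⟩; exact congrArg (Quotient.mk _) (cr2 a)
  cr3 := by rintro ⟨a⟩; exact congrArg (Quotient.mk _) (cr3 a)
  cr4 := by rintro ⟨a⟩ ⟨b⟩; exact congrArg (Quotient.mk _) (cr4 a b)
  cr5 := by rintro ⟨a⟩; exact congrArg (Quotient.mk _) (cr5 a)

variable (S) in
/-- The greatest distributive lattice quotient. -/
def latticeQuotient : RawSemiring.{u} where
  carrier := Quotient (latticeSetoid S)
  add := Quotient.map₂ (· + ·) fun _ _ h _ _ h' => lattice_add h h'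
  mul := Quotient.map₂ (· * ·) fun _ _ h _ _ h' => lattice_mul h h'
  add_assoc := by
    rintro ⟨a⟩ ⟨b⟩ ⟨c⟩; exact congrArg (Quotient.mk _) (add_assoc a b c)
  mul_assoc := by
    rintro ⟨a⟩ ⟨b⟩ ⟨c⟩; exact congrArg (Quotient.mk _) (mul_assoc' a b c)
  left_distrib := by
    rintro ⟨a⟩ ⟨b⟩ ⟨c⟩; exact congrArg (Quotient.mk _) (left_distrib' a b c)
  right_distrib := by
    rintro ⟨a⟩ ⟨b⟩ ⟨c⟩; exact congrArg (Quotient.mk _) (right_distrib' a b c)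

theorem isBandSemiring_idempotents : (idempotents S).IsBandSemiring :=
  ⟨fun e => Subtype.ext e.2, fun e => Subtype.ext (mul_self_of_idem e.2),
    fun e f => Subtype.ext (below_sandwich e.2 f.2)⟩

theorem isWeakClifford_cliffordQuotient : (cliffordQuotient S).IsWeakClifford := by
  refine ⟨?_, (cliffordQuotient S).cr5, ?_, ?_⟩
  · rintro ⟨a⟩ ⟨b⟩
    refine Quotient.sound (fun u hu => ⟨?_, fun k => ?_⟩)
    · rw [below_o_add_iff hu, below_o_add_iff hu, and_comm]
    · obtain ⟨k1, k2⟩ := (below_o_add_iff hu).1 k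
      exact sandwich_comm hu k1 k2
  · rintro ⟨a⟩ ⟨b⟩
    refine Quotient.sound (clifford_of_idem ?_ ?_ (lattice_mul_comm a (o b)))
    · change a * o b + a * o b = a * o b
      rw [o_mul_right, o_idem]
    · exact mul_idem a (o_idem b)
  · rintro ⟨a⟩ ⟨b⟩
    exact Quotient.sound (clifford_absorb a b)

theorem isDistLat_latticeQuotient : (latticeQuotient S).IsDistLat := by
  refine ⟨?_, ?_, ?_, ?_, ?_⟩
  · rintro ⟨a⟩
    refine Quotient.sound (fun u hu => ?_)
    rw [below_o_add_iff hu, and_self]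
  · rintro ⟨a⟩
    refine Quotient.sound (fun u hu => ?_)
    rw [o_mul, mul_self_of_idem (o_idem a)]
  · rintro ⟨a⟩ ⟨b⟩
    refine Quotient.sound (fun u hu => ?_)
    rw [below_o_add_iff hu, below_o_add_iff hu, and_comm]
  · rintro ⟨a⟩ ⟨b⟩
    exact Quotient.sound (lattice_mul_comm a b)
  · rintro ⟨a⟩ ⟨b⟩
    exact Quotient.sound (lattice_absorb a b)

theorem lattice_o (a : S) : latticeSetoid S (o a) a := fun u hu => by
  rw [o_of_idem (o_idem a)]

variable (S) in
theorem exists_spined_product :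
    ∃ (S₁ : RawSemiring.{u}) (S₂ : RawCRSemiring.{u}) (T : RawSemiring.{u})
      (φ₁ : S₁.carrier → T.carrier) (φ₂ : S₂.carrier → T.carrier)
      (θ : S → S₁.carrier × S₂.carrier),
      S₁.IsBandSemiring ∧
      S₂.IsWeakClifford ∧
      T.IsDistLat ∧
      IsHom S₁.add S₁.mul T.add T.mul φ₁ ∧ Function.Surjective φ₁ ∧
      IsHom S₂.add S₂.mul T.add T.mul φ₂ ∧ Function.Surjective φ₂ ∧
      (∀ a : S, φ₁ (θ a).1 = φ₂ (θ a).2) ∧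
      Function.Injective θ ∧
      (∀ p : S₁.carrier × S₂.carrier, φ₁ p.1 = φ₂ p.2 → ∃ a : S, θ a = p) ∧
      (∀ a b : S,
        θ (a + b) = (S₁.add (θ a).1 (θ b).1, S₂.add (θ a).2 (θ b).2)) ∧
      (∀ a b : S,
        θ (a * b) = (S₁.mul (θ a).1 (θ b).1, S₂.mul (θ a).2 (θ b).2)) := by
  refine ⟨idempotents S, cliffordQuotient S, latticeQuotient S,
    fun e => Quotient.mk (latticeSetoid S) e.1,
    Quotient.map' id fun _ _ h => lattice_of_clifford h,
    fun a => (⟨o a, o_idem a⟩, Quotient.mk (cliffordSetoid S) a),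
    isBandSemiring_idempotents, isWeakClifford_cliffordQuotient, isDistLat_latticeQuotient,
    ⟨fun _ _ => rfl, fun _ _ => rfl⟩, ?_, ⟨?_, ?_⟩, ?_, ?_, ?_, ?_, ?_, ?_⟩
  · rintro ⟨a⟩
    exact ⟨⟨o a, o_idem a⟩, Quotient.sound (lattice_o a)⟩
  · rintro ⟨a⟩ ⟨b⟩; rfl
  · rintro ⟨a⟩ ⟨b⟩; rfl
  · rintro ⟨a⟩
    exact ⟨Quotient.mk _ a, rfl⟩
  · exact fun a => Quotient.sound (lattice_o a)
  · intro a b h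
    have h1 : o a = o b := congrArg Subtype.val (Prod.ext_iff.1 h).1
    have h2 : cliffordSetoid S a b := Quotient.exact (Prod.ext_iff.1 h).2
    rw [eq_of_clifford h2, h1, o_add, add_o]
  · rintro ⟨⟨e, he⟩, ⟨b⟩⟩ h
    have h' : latticeSetoid S e b := Quotient.exact h
    refine ⟨e + b + e, Prod.ext (Subtype.ext ?_) (Quotient.sound (clifford_sandwich he h'))⟩
    have := (lattice_iff.1 h').1
    rw [o_of_idem he] at this
    change o (e + b + e) = e
    rw [o_add_eq, o_add_eq, o_of_idem he]
    exact this
  · exact fun a b => Prod.ext (Subtype.ext (o_add_eq a b)) rfl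
  · exact fun a b => Prod.ext (Subtype.ext (o_mul a b)) rfl

end BandOrthoring

namespace RawSemiring.IsBandSemiring

variable {A : RawSemiring.{u}}

theorem add_mul_add (h : A.IsBandSemiring) (x y : A.carrier) :
    A.add (A.add x (A.mul x y)) x = x := by
  have := h.2.2 x (A.mul x y)
  rwa [A.mul_assoc x y x, A.mul_assoc, A.mul_assoc y, ← A.mul_assoc x x, h.2.1,
    ← A.mul_assoc, h.2.1] at this

theorem add_mul_add' (h : A.IsBandSemiring) (x y : A.carrier) :
    A.add (A.add x (A.mul y x)) x = x := by
  have := h.2.2 x (A.mul y x)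
  rwa [A.mul_assoc y x x, h.2.1, h.2.1] at this

end RawSemiring.IsBandSemiring

namespace RawCRSemiring.IsWeakClifford

variable {A : RawCRSemiring.{u}}

theorem add_inv_of_idem (h : A.IsWeakClifford) {e : A.carrier} (he : A.add e e = e) :
    A.add e (A.inv e) = e := by
  have h1 := A.cr1 e
  rwa [A.add_assoc, h.1 _ e, ← A.add_assoc, he] at h1

theorem add_add_self (h : A.IsWeakClifford) {e f : A.carrier} (he : A.add e e = e)
    (hf : A.add f f = f) : A.add (A.add e f) (A.add e f) = A.add e f := by
  rw [A.add_assoc, ← A.add_assoc f, h.1 f e, A.add_assoc e f f, hf, ← A.add_assoc, he]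

theorem add_mul_add (h : A.IsWeakClifford) {e f : A.carrier} (he : A.add e e = e)
    (hf : A.add f f = f) : A.add (A.add e (A.mul e f)) e = e := by
  have h2 := h.2.2.2 e f
  rw [h.add_inv_of_idem hf] at h2
  rw [h2, he]

theorem add_mul_add' (h : A.IsWeakClifford) {e f : A.carrier} (he : A.add e e = e)
    (hf : A.add f f = f) : A.add (A.add e (A.mul f e)) e = e := by
  have h2 := h.2.2.1 e f
  rw [h.add_inv_of_idem hf] at h2
  rw [← h2, h.add_mul_add he hf]

end RawCRSemiring.IsWeakClifford

/-- A (completely regular) semiring is a band orthoring iff it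
is a spined product of a band semiring and a weak Clifford semiring with
respect to a distributive lattice. -/
theorem band_orthorings_stmt16
    {S : Type u} [Add S] [Mul S] (inv : S → S)
    (add_assoc : ∀ a b c : S, a + b + c = a + (b + c))
    (mul_assoc : ∀ a b c : S, a * b * c = a * (b * c))
    (left_distrib : ∀ a b c : S, a * (b + c) = a * b + a * c)
    (right_distrib : ∀ a b c : S, (a + b) * c = a * c + b * c)
    (cr1 : ∀ x : S, x + inv x + x = x)
    (cr2 : ∀ x : S, x + inv x = inv x + x)
    (cr3 : ∀ x : S, inv (inv x) = x)
    (cr4 : ∀ x y : S,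
      x + (y + inv y) + (x + inv x) + y = (x + inv x) + y + x + (y + inv y))
    (cr5 : ∀ x : S, x * (x + inv x) = x + inv x) :
    -- S is a band orthoring
    ((∀ e f : S, e + e = e → f + f = f →
        ((e + f) + (e + f) = e + f ∧ (e * f) + (e * f) = e * f)) ∧
      (∀ e f : S, e + e = e → f + f = f →
        (e + e * f + e = e ∧ e + f * e + e = e))) ↔
      -- S is a spined product of a band semiring and a weak Clifford
      -- semiring with respect to a distributive lattice
      ∃ (S₁ : RawSemiring.{u}) (S₂ : RawCRSemiring.{u}) (T : RawSemiring.{u})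
        (φ₁ : S₁.carrier → T.carrier) (φ₂ : S₂.carrier → T.carrier)
        (θ : S → S₁.carrier × S₂.carrier),
        S₁.IsBandSemiring ∧
        S₂.IsWeakClifford ∧
        T.IsDistLat ∧
        IsHom S₁.add S₁.mul T.add T.mul φ₁ ∧ Function.Surjective φ₁ ∧
        IsHom S₂.add S₂.mul T.add T.mul φ₂ ∧ Function.Surjective φ₂ ∧
        (∀ a : S, φ₁ (θ a).1 = φ₂ (θ a).2) ∧
        Function.Injective θ ∧
        (∀ p : S₁.carrier × S₂.carrier, φ₁ p.1 = φ₂ p.2 → ∃ a : S, θ a = p) ∧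
        (∀ a b : S,
          θ (a + b) = (S₁.add (θ a).1 (θ b).1, S₂.add (θ a).2 (θ b).2)) ∧
        (∀ a b : S,
          θ (a * b) = (S₁.mul (θ a).1 (θ b).1, S₂.mul (θ a).2 (θ b).2)) := by
  constructor
  · rintro ⟨h1, h2⟩
    exact @BandOrthoring.exists_spined_product S
      { add_assoc := add_assoc
        inv := inv
        mul_assoc' := mul_assoc
        left_distrib' := left_distrib
        right_distrib' := right_distrib
        cr1 := cr1
        cr2 := cr2
        cr3 := cr3
        cr4 := cr4
        cr5 := cr5
        idem_add := fun he hf => (h1 _ _ he hf).1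
        band_right := fun he hf => (h2 _ _ he hf).1
        band_left := fun he hf => (h2 _ _ he hf).2 }
  · rintro ⟨S₁, S₂, T, φ₁, φ₂, θ, hB, hC, -, -, -, -, -, -, inj, -, hadd, hmul⟩
    have idem : ∀ {e : S}, e + e = e → S₂.add (θ e).2 (θ e).2 = (θ e).2 := fun {e} he => by
      have := hadd e e
      rw [he] at this
      exact (congrArg Prod.snd this).symm
    refine ⟨fun e f he hf => ⟨inj ?_, ?_⟩, fun e f he hf => ⟨inj ?_, inj ?_⟩⟩
    · simp only [hadd, hB.1, hC.add_add_self (idem he) (idem hf)]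
    · rw [← left_distrib, hf]
    · simp only [hadd, hmul, hB.add_mul_add, hC.add_mul_add (idem he) (idem hf)]
    · simp only [hadd, hmul, hB.add_mul_add', hC.add_mul_add' (idem he) (idem hf)]
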